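/- Let V be a nonzero Banach 𝕆-bimodule and T a power-associative bounded right para-linear operator on V. Then every s ∈ 𝕆 with |s| > ‖T‖ lies in the push-forward resolvent set ρ_*(T), and for every J ∈ 𝕊 the slice push-forward spectrum σ_{*J}(T) := ℂ_J ∖ ρ_{*J}(T) is a nonempty compact subset of ℂ_J contained in the closed disk of radius ‖T‖. -/

import Mathlib

noncomputable section

open scoped BigOperators

/-- Octonions, realized via the Cayley–Dickson doubling of the quaternions. -/
@[ext]
structure Oct : Type where
  a : Quaternion ℝ
  b : Quaternion ℝ

namespace Oct

instance : Zero Oct := ⟨⟨0, 0⟩⟩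
instance : Add Oct := ⟨fun x y => ⟨x.a + y.a, x.b + y.b⟩⟩
instance : Neg Oct := ⟨fun x => ⟨-x.a, -x.b⟩⟩
instance : Sub Oct := ⟨fun x y => ⟨x.a - y.a, x.b - y.b⟩⟩
instance : SMul ℕ Oct := ⟨fun n x => ⟨n • x.a, n • x.b⟩⟩
instance : SMul ℤ Oct := ⟨fun n x => ⟨n • x.a, n • x.b⟩⟩
instance : SMul ℝ Oct := ⟨fun r x => ⟨r • x.a, r • x.b⟩⟩

def toLp (x : Oct) : WithLp 2 (Quaternion ℝ × Quaternion ℝ) :=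
  (WithLp.equiv 2 (Quaternion ℝ × Quaternion ℝ)).symm (x.a, x.b)

lemma toLp_injective : Function.Injective toLp := by
  rintro ⟨xa, xb⟩ ⟨ya, yb⟩ h
  have ha : xa = ya :=
    congrArg (fun z => (WithLp.equiv 2 (Quaternion ℝ × Quaternion ℝ) z).1) h
  have hb : xb = yb :=
    congrArg (fun z => (WithLp.equiv 2 (Quaternion ℝ × Quaternion ℝ) z).2) h
  subst ha; subst hb; rfl

instance : AddCommGroup Oct :=
  toLp_injective.addCommGroup toLp rfl (fun _ _ => rfl) (fun _ => rfl) (fun _ _ => rfl)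
    (fun _ _ => rfl) (fun _ _ => rfl)

def toLpHom : Oct →+ WithLp 2 (Quaternion ℝ × Quaternion ℝ) where
  toFun := toLp
  map_zero' := rfl
  map_add' _ _ := rfl

instance : Module ℝ Oct := toLp_injective.module ℝ toLpHom fun _ _ => rfl

instance : NormedAddCommGroup Oct :=
  NormedAddCommGroup.induced Oct (WithLp 2 (Quaternion ℝ × Quaternion ℝ)) toLpHom toLp_injective

instance : NormedSpace ℝ Oct := ⟨fun r x => norm_smul_le r (toLp x)⟩

def toProdLin : Oct →ₗ[ℝ] Quaternion ℝ × Quaternion ℝ where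
  toFun x := (x.a, x.b)
  map_add' _ _ := rfl
  map_smul' _ _ := rfl

lemma toProdLin_injective : Function.Injective toProdLin := by
  rintro ⟨xa, xb⟩ ⟨ya, yb⟩ h
  have ha : xa = ya := congrArg Prod.fst h
  have hb : xb = yb := congrArg Prod.snd h
  subst ha; subst hb; rfl

instance : FiniteDimensional ℝ Oct :=
  FiniteDimensional.of_injective toProdLin toProdLin_injective

instance : CompleteSpace Oct := FiniteDimensional.complete ℝ Oct

instance : One Oct := ⟨⟨1, 0⟩⟩

instance : Mul Oct :=
  ⟨fun x y => ⟨x.a * y.a - star y.b * x.b, y.b * x.a + x.b * star y.a⟩⟩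

/-- Octonionic conjugation. -/
def conj (x : Oct) : Oct := ⟨star x.a, -x.b⟩

/-- The real part of an octonion. -/
def re (x : Oct) : ℝ := x.a.re

/-- Powers of an octonion (association chosen on the left factor). -/
def opow (s : Oct) : ℕ → Oct
  | 0 => 1
  | n + 1 => s * opow s n

/-- The inverse of a nonzero octonion. -/
def oinv (s : Oct) : Oct := (‖s‖ ^ 2)⁻¹ • conj s

/-- `invPow s n` is the octonion `s ^ (-1 - n)`. -/
def invPow (s : Oct) (n : ℕ) : Oct := opow (oinv s) (n + 1)

def eNat : ℕ → Oct
  | 0 => ⟨1, 0⟩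
  | 1 => ⟨⟨0, 1, 0, 0⟩, 0⟩
  | 2 => ⟨⟨0, 0, 1, 0⟩, 0⟩
  | 3 => ⟨⟨0, 0, 0, 1⟩, 0⟩
  | 4 => ⟨0, 1⟩
  | 5 => ⟨0, ⟨0, 1, 0, 0⟩⟩
  | 6 => ⟨0, ⟨0, 0, 1, 0⟩⟩
  | 7 => ⟨0, ⟨0, 0, 0, 1⟩⟩
  | _ => 0

/-- The standard basis `e_0 = 1, e_1, …, e_7` of the octonions. -/
def e (i : Fin 8) : Oct := eNat i.val

/-- The six-dimensional sphere `𝕊` of imaginary units of `𝕆`. -/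
def unitSphere : Set Oct := {J | J * J = -1}

/-- The slice `ℂ_J = ℝ ⊕ ℝJ` of the octonions. -/
def sliceC (J : Oct) : Set Oct := {s | ∃ x y : ℝ, s = x • (1 : Oct) + y • J}

/-- The embedding of `ℂ` onto the slice `ℂ_J`, `x + y i ↦ x + y J`. -/
def toSlice (J : Oct) (z : ℂ) : Oct := z.re • (1 : Oct) + z.im • J

end Oct

open Oct

/-- A (normed/Banach) `𝕆`-bimodule: a real normed space with continuous real-bilinear left and
right octonionic multiplications satisfying the alternativity relations
`[p,q,x] = [q,x,p] = [x,p,q] = -[q,p,x]` and the norm identities `‖px‖ = |p|‖x‖ = ‖xp‖`. -/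
class OctBimodule (V : Type*) [NormedAddCommGroup V] [NormedSpace ℝ V] : Type _ where
  lm : Oct →ₗ[ℝ] V →L[ℝ] V
  rm : Oct →ₗ[ℝ] V →L[ℝ] V
  lm_one : ∀ x : V, lm 1 x = x
  rm_one : ∀ x : V, rm 1 x = x
  /-- `[p,q,x] = [q,x,p]` -/
  assoc_cyc₁ : ∀ (p q : Oct) (x : V),
    lm (p * q) x - lm p (lm q x) = rm p (lm q x) - lm q (rm p x)
  /-- `[p,q,x] = [x,p,q]` -/
  assoc_cyc₂ : ∀ (p q : Oct) (x : V),
    lm (p * q) x - lm p (lm q x) = rm q (rm p x) - rm (p * q) x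
  /-- `[p,q,x] = -[q,p,x]` -/
  assoc_alt : ∀ (p q : Oct) (x : V),
    lm (p * q) x - lm p (lm q x) = -(lm (q * p) x - lm q (lm p x))
  norm_lm : ∀ (p : Oct) (x : V), ‖lm p x‖ = ‖p‖ * ‖x‖
  norm_rm : ∀ (p : Oct) (x : V), ‖rm p x‖ = ‖p‖ * ‖x‖

section OctMod

variable {V : Type*} [NormedAddCommGroup V] [NormedSpace ℝ V] [OctBimodule V]

/-- Left multiplication `x ↦ p x` as a bounded real-linear operator. -/
def lmo (p : Oct) : V →L[ℝ] V := OctBimodule.lm p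

/-- Right multiplication `R_p : x ↦ x p` as a bounded real-linear operator. -/
def rmo (p : Oct) : V →L[ℝ] V := OctBimodule.rm p

variable (V)

/-- The real-part projection `Re x = (5/12) x - (1/12) ∑_{i=1}^7 e_i x e_i` of an
`𝕆`-bimodule. -/
def reO : V →L[ℝ] V :=
  (5 / 12 : ℝ) • ContinuousLinearMap.id ℝ V -
    (1 / 12 : ℝ) • ∑ i : Fin 7, (rmo (e i.succ)).comp (lmo (e i.succ))

/-- The real part `Re V` of an `𝕆`-bimodule, i.e. the set of associative central elements. -/
def ReSet : Set V :=
  {m | (∀ p q : Oct, lmo (p * q) m = lmo p (lmo q m)) ∧ ∀ p : Oct, lmo p m = rmo p m}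

/-- The slice `ℂ_J(V) = Re V ⊕ J · Re V` of an `𝕆`-bimodule. -/
def CJV (J : Oct) : Set V :=
  {x | ∃ u ∈ ReSet V, ∃ w ∈ ReSet V, x = u + lmo J w}

/-- The slice projection `π_J(x) = Re x + J Re (J̄ x)`. -/
def piJ (J : Oct) : V →L[ℝ] V :=
  reO V + (lmo J).comp ((reO V).comp (lmo (Oct.conj J)))

variable {V}

/-- The second right associator `B_p(T, x) = T(x) p - T(x p)` of an operator. -/
def Bop (p : Oct) (T : V →L[ℝ] V) : V →L[ℝ] V := (rmo p).comp T - T.comp (rmo p)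

/-- A bounded real-linear operator is right (octonionic) para-linear if `Re B_p(T,x) = 0`. -/
def IsRightPara (T : V →L[ℝ] V) : Prop := ∀ (p : Oct) (x : V), reO V (Bop p T x) = 0

/-- The left octonionic scalar multiplication `(p ⊙ T)(x) = p T(x) + B_p(T,x)` on operators. -/
def odotL (p : Oct) (T : V →L[ℝ] V) : V →L[ℝ] V := (lmo p).comp T + Bop p T

/-- The right octonionic scalar multiplication `(T ⊙ p)(x) = T(p x) - B_p(T,x)` on operators. -/
def odotR (T : V →L[ℝ] V) (p : Oct) : V →L[ℝ] V := T.comp (lmo p) - Bop p T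

/-- The lifting map, `(lif F)(x) = ∑_i F(x ē_i) e_i`. -/
def lifO (F : V →L[ℝ] V) : V →L[ℝ] V :=
  ∑ i : Fin 8, (rmo (e i)).comp (F.comp (rmo (Oct.conj (e i))))

/-- The extension map, `(ext G)(∑ x_i e_i) = ∑ G(x_i) e_i`, where `x_i = Re (x ē_i)`. -/
def extO (G : V →L[ℝ] V) : V →L[ℝ] V :=
  ∑ i : Fin 8, (rmo (e i)).comp (G.comp ((reO V).comp (rmo (Oct.conj (e i)))))

/-- The left regular power `T^{n⊚} = lif (Re ∘ Tⁿ)`. -/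
def rpowL (T : V →L[ℝ] V) (n : ℕ) : V →L[ℝ] V := lifO ((reO V).comp (T ^ n))

/-- The right regular power `T^{⊚n} = ext (Tⁿ|_{Re V})`. -/
def rpowR (T : V →L[ℝ] V) (n : ℕ) : V →L[ℝ] V := extO (T ^ n)

/-- The regular composition `f ⊚ g = lif (Re ∘ f ∘ g)`. -/
def rcomp (f g : V →L[ℝ] V) : V →L[ℝ] V := lifO ((reO V).comp (f.comp g))

/-- The composition associator `[f,g,x]_⊚ = (f ⊚ g)(x) - f(g(x))`. -/
def compAssoc (f g : V →L[ℝ] V) (x : V) : V := rcomp f g x - f (g x)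

/-- The right regular inverse `T^{⊚-} = ext (T⁻¹|_{Re V})` of an invertible operator. -/
def rinvR (T : V →L[ℝ] V) : V →L[ℝ] V := extO (Ring.inverse T)

/-- The left regular inverse `T^{-⊚} = lif (Re ∘ T⁻¹)` of an invertible operator. -/
def rinvL (T : V →L[ℝ] V) : V →L[ℝ] V := lifO ((reO V).comp (Ring.inverse T))

/-- An operator is power-associative if all of its (composition) powers are right
para-linear. -/
def IsPowerAssoc (T : V →L[ℝ] V) : Prop := ∀ n : ℕ, IsRightPara (T ^ n)

/-- A bounded operator is octonionic linear if `T(xp) = T(x)p` for all `p`. -/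
def IsOctLinear (T : V →L[ℝ] V) : Prop := ∀ (p : Oct) (x : V), T (rmo p x) = rmo p (T x)

/-- `S` is `ℂ_J`-extendable power associative: `Sⁿ(v s) = Sⁿ(v) s` for `v ∈ Re V`,
`s ∈ ℂ_J`, `n ≥ 1`. -/
def CJExtPA (J : Oct) (S : V →L[ℝ] V) : Prop :=
  ∀ n : ℕ, 1 ≤ n → ∀ v ∈ ReSet V, ∀ s ∈ sliceC J, (S ^ n) (rmo s v) = rmo s ((S ^ n) v)

/-- `S` is `ℂ_J`-liftable power associative: `Re (Sⁿ(v s)) = Re (Sⁿ(v) s)` for all `v ∈ V`,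
`s ∈ ℂ_J`, `n ≥ 1`. -/
def CJLiftPA (J : Oct) (S : V →L[ℝ] V) : Prop :=
  ∀ n : ℕ, 1 ≤ n → ∀ (v : V), ∀ s ∈ sliceC J,
    reO V ((S ^ n) (rmo s v)) = reO V (rmo s ((S ^ n) v))

/-- The pull-back slice-resolvent set `ρ*_J(T)`. -/
def pbResSlice (T : V →L[ℝ] V) (J : Oct) : Set Oct :=
  {s | s ∈ sliceC J ∧ IsUnit ((rmo s : V →L[ℝ] V) - T) ∧
    CJExtPA J (Ring.inverse ((rmo s : V →L[ℝ] V) - T))}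

/-- The pull-back resolvent set `ρ*(T)`. -/
def pbRes (T : V →L[ℝ] V) : Set Oct := ⋃ J ∈ unitSphere, pbResSlice T J

/-- The pull-back spectrum `σ*(T) = 𝕆 ∖ ρ*(T)`. -/
def pbSpec (T : V →L[ℝ] V) : Set Oct := Set.univ \ pbRes T

/-- The push-forward slice-resolvent set `ρ_{*J}(T)`. -/
def pfResSlice (T : V →L[ℝ] V) (J : Oct) : Set Oct :=
  {s | s ∈ sliceC J ∧ IsUnit ((rmo s : V →L[ℝ] V) - T) ∧
    CJLiftPA J (Ring.inverse ((rmo s : V →L[ℝ] V) - T))}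

/-- The push-forward resolvent set `ρ_*(T)`. -/
def pfRes (T : V →L[ℝ] V) : Set Oct := ⋃ J ∈ unitSphere, pfResSlice T J

/-- The push-forward spectrum `σ_*(T) = 𝕆 ∖ ρ_*(T)`. -/
def pfSpec (T : V →L[ℝ] V) : Set Oct := Set.univ \ pfRes T

/-- The real-part projection of the `𝕆`-bimodule `𝓑_RO(V)` of bounded right para-linear
operators, given by `Re A = (5/12) A - (1/12) ∑_{i=1}^7 (e_i ⊙ A) ⊙ e_i`. -/
def reOpB (A : V →L[ℝ] V) : V →L[ℝ] V :=
  (5 / 12 : ℝ) • A - (1 / 12 : ℝ) • ∑ i : Fin 7, odotR (odotL (e i.succ) A) (e i.succ)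

end OctMod

/-- A set `U ⊆ 𝕆` is slice-open if `U ∩ ℂ_J` is open in `ℂ_J` for every `J ∈ 𝕊`. -/
def SliceOpen (U : Set Oct) : Prop :=
  ∀ J ∈ unitSphere, IsOpen (Oct.toSlice J ⁻¹' U)

/-- A parametrization of the boundary `∂(U ∩ ℂ_J)` by finitely many continuously
differentiable, positively oriented Jordan curves (positivity of the orientation is encoded
through the winding numbers). -/
structure SliceContour (J : Oct) (U : Set Oct) where
  n : ℕ
  γ : Fin n → ℝ → ℂ
  smooth : ∀ i, ContDiff ℝ 1 (γ i)
  closed : ∀ i, γ i 0 = γ i 1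
  jordan : ∀ i, Set.InjOn (γ i) (Set.Ico (0 : ℝ) 1)
  image_eq : (⋃ i, γ i '' Set.Icc (0 : ℝ) 1) = frontier (Oct.toSlice J ⁻¹' U)
  winding_inside : ∀ z : ℂ, Oct.toSlice J z ∈ U →
    (∑ i, ∫ t in (0 : ℝ)..1, deriv (γ i) t / (γ i t - z)) = 2 * (Real.pi : ℂ) * Complex.I
  winding_outside : ∀ z : ℂ, Oct.toSlice J z ∉ closure U →
    (∑ i, ∫ t in (0 : ℝ)..1, deriv (γ i) t / (γ i t - z)) = 0

/-- The integral `∫_{∂(U ∩ ℂ_J)} Φ(s, ds)` along a slice contour: the integrand gets the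
point of the curve and its derivative (both in the coordinates of the slice). -/
def contourSum {J : Oct} {U : Set Oct} (Γ : SliceContour J U) {E : Type*}
    [NormedAddCommGroup E] [NormedSpace ℝ E] (Φ : ℂ → ℂ → E) : E :=
  ∑ i, ∫ t in (0 : ℝ)..1, Φ (Γ.γ i t) (deriv (Γ.γ i) t)

/-- An axially symmetric slice domain (s-domain) in `𝕆`. -/
structure IsAdmissibleDomain (U : Set Oct) : Prop where
  isOpen : IsOpen U
  isConnected : IsConnected U
  real_nonempty : (U ∩ {s : Oct | ∃ r : ℝ, s = r • (1 : Oct)}).Nonempty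
  axially : ∀ (z : ℂ), ∀ I ∈ unitSphere, ∀ J ∈ unitSphere,
    Oct.toSlice I z ∈ U → Oct.toSlice J z ∈ U
  slice_conn : ∀ J ∈ unitSphere, IsConnected (Oct.toSlice J ⁻¹' U)

section Adm

variable {V : Type*} [NormedAddCommGroup V] [NormedSpace ℝ V] [OctBimodule V]

/-- A `T`-left-admissible domain: an axially symmetric s-domain containing the pull-back
spectrum `σ*(T)`.  (The regularity of its slice boundaries is witnessed by the slice
contours used in the integrals.) -/
def LeftAdmissible (T : V →L[ℝ] V) (U : Set Oct) : Prop :=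
  IsAdmissibleDomain U ∧ pbSpec T ⊆ U

/-- A `T`-right-admissible domain: an axially symmetric s-domain containing the push-forward
spectrum `σ_*(T)`. -/
def RightAdmissible (T : V →L[ℝ] V) (U : Set Oct) : Prop :=
  IsAdmissibleDomain U ∧ pfSpec T ⊆ U

end Adm

/-- The axially symmetric set `Ω_D ⊆ 𝕆` induced by a conjugation-invariant set `D ⊆ ℂ`. -/
def OmegaD (D : Set ℂ) : Set Oct := ⋃ J ∈ unitSphere, Oct.toSlice J '' D

/-- `F` is the stem of a slice preserving slice regular function on `Ω_D`: it is holomorphic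
on the open conjugation-invariant set `D` and intertwines complex conjugation. -/
structure IsStem (D : Set ℂ) (F : ℂ → ℂ) : Prop where
  isOpen : IsOpen D
  conj_mem : ∀ z ∈ D, (starRingEnd ℂ) z ∈ D
  holo : DifferentiableOn ℂ F D
  conj_comm : ∀ z ∈ D, F ((starRingEnd ℂ) z) = (starRingEnd ℂ) (F z)

section FC

variable {V : Type*} [NormedAddCommGroup V] [NormedSpace ℝ V] [OctBimodule V]

/-- The slice integral `(1/2π) ∫_{∂(U∩ℂ_J)} (R_s - T)^{⊚-} ⊙ (ds_J f(s))` defining the left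
slice regular functional calculus of a slice preserving function with stem `F`. -/
def leftFC (T : V →L[ℝ] V) (J : Oct) {U : Set Oct} (Γ : SliceContour J U)
    (F : ℂ → ℂ) : V →L[ℝ] V :=
  (2 * Real.pi)⁻¹ • contourSum Γ fun z dz =>
    odotR (rinvR ((rmo (Oct.toSlice J z) : V →L[ℝ] V) - T))
      ((-(Oct.toSlice J dz) * J) * Oct.toSlice J (F z))

/-- The slice integral `(1/2π) ∫_{∂(U∩ℂ_J)} (f(s) ds_J) ⊙ (R_s - T)^{-⊚}` defining the right
slice regular functional calculus of a slice preserving function with stem `F`. -/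
def rightFC (T : V →L[ℝ] V) (J : Oct) {U : Set Oct} (Γ : SliceContour J U)
    (F : ℂ → ℂ) : V →L[ℝ] V :=
  (2 * Real.pi)⁻¹ • contourSum Γ fun z dz =>
    odotL (Oct.toSlice J (F z) * (-(Oct.toSlice J dz) * J))
      (rinvL ((rmo (Oct.toSlice J z) : V →L[ℝ] V) - T))

end FC

/-- The family of stems of the components, relative to `J = ∑ c_i e_i`, of a function of the
form `f₀ + f₁ • J` with `f₀, f₁` slice preserving with stems `F₀, F₁`. -/
def stemFamily (c : Fin 8 → ℝ) (F₀ F₁ : ℂ → ℂ) : Fin 8 → ℂ → ℂ :=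
  fun i z => if i = 0 then F₀ z else (c i : ℂ) * F₁ z

namespace Oct

/-- Left multiplication by an octonion, as a real-linear map. -/
def lmulLin (q : Oct) : Oct →ₗ[ℝ] Oct where
  toFun x := q * x
  map_add' x y := by
    refine Oct.ext ?_ ?_
    · show q.a * (x.a + y.a) - star (x.b + y.b) * q.b =
        (q.a * x.a - star x.b * q.b) + (q.a * y.a - star y.b * q.b)
      rw [mul_add, star_add, add_mul]; abel
    · show (x.b + y.b) * q.a + q.b * star (x.a + y.a) =
        (x.b * q.a + q.b * star x.a) + (y.b * q.a + q.b * star y.a)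
      rw [add_mul, star_add, mul_add]; abel
  map_smul' r x := by
    refine Oct.ext ?_ ?_
    · show q.a * (r • x.a) - star (r • x.b) * q.b = r • (q.a * x.a - star x.b * q.b)
      rw [mul_smul_comm, Quaternion.star_smul, smul_mul_assoc, smul_sub]
    · show (r • x.b) * q.a + q.b * star (r • x.a) = r • (x.b * q.a + q.b * star x.a)
      rw [smul_mul_assoc, Quaternion.star_smul, mul_smul_comm, smul_add]

/-- Left multiplication `L_q : x ↦ q x` as a bounded real-linear operator on `𝕆`. -/
def Lq (q : Oct) : Oct →L[ℝ] Oct := (lmulLin q).toContinuousLinearMap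

/-- The two-sphere `[q] = {Re q + |Im q| J : J ∈ 𝕊}` associated with an octonion `q`. -/
def qSphere (q : Oct) : Set Oct :=
  {s | ∃ J ∈ unitSphere, s = Oct.re q • (1 : Oct) + ‖q - Oct.re q • (1 : Oct)‖ • J}

end Oct

open scoped Quaternion

namespace Oct

lemma neg_a (x : Oct) : (-x).a = -x.a := rfl
lemma neg_b (x : Oct) : (-x).b = -x.b := rfl
lemma smul_a (r : ℝ) (x : Oct) : (r • x).a = r • x.a := rfl
lemma smul_b (r : ℝ) (x : Oct) : (r • x).b = r • x.b := rfl
lemma one_a : (1 : Oct).a = 1 := rfl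
lemma one_b : (1 : Oct).b = 0 := rfl
lemma mul_a (x y : Oct) : (x * y).a = x.a * y.a - star y.b * x.b := rfl
lemma mul_b (x y : Oct) : (x * y).b = y.b * x.a + x.b * star y.a := rfl
lemma sub_a (x y : Oct) : (x - y).a = x.a - y.a := rfl
lemma sub_b (x y : Oct) : (x - y).b = x.b - y.b := rfl

lemma ext_coords {x y : Oct} (h₀ : x.a.re = y.a.re) (h₁ : x.a.imI = y.a.imI)
    (h₂ : x.a.imJ = y.a.imJ) (h₃ : x.a.imK = y.a.imK) (h₄ : x.b.re = y.b.re)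
    (h₅ : x.b.imI = y.b.imI) (h₆ : x.b.imJ = y.b.imJ) (h₇ : x.b.imK = y.b.imK) : x = y :=
  Oct.ext (Quaternion.ext _ _ h₀ h₁ h₂ h₃) (Quaternion.ext _ _ h₄ h₅ h₆ h₇)

/-- The octonionic units `p, q, r` multiply like `i, j, k` in the quaternions. -/
structure IsTriple (p q r : Oct) : Prop where
  sq₁ : p * p = -1
  sq₂ : q * q = -1
  sq₃ : r * r = -1
  mul₁₂ : p * q = r
  mul₂₃ : q * r = p
  mul₃₁ : r * p = q
  mul₂₁ : q * p = -r
  mul₃₂ : r * q = -p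
  mul₁₃ : p * r = -q

lemma IsTriple.rotate {p q r : Oct} (h : IsTriple p q r) : IsTriple q r p :=
  ⟨h.sq₂, h.sq₃, h.sq₁, h.mul₂₃, h.mul₃₁, h.mul₁₂, h.mul₃₂, h.mul₁₃, h.mul₂₁⟩

lemma isTriple_e_one_two_three : IsTriple (e 1) (e 2) (e 3) := by
  constructor <;> apply ext_coords <;>
    simp [mul_a, mul_b, neg_a, neg_b, one_a, one_b] <;> simp [e, eNat]

lemma isTriple_e_one_four_five : IsTriple (e 1) (e 4) (e 5) := by
  constructor <;> apply ext_coords <;>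
    simp [mul_a, mul_b, neg_a, neg_b, one_a, one_b] <;> simp [e, eNat]

lemma isTriple_e_one_seven_six : IsTriple (e 1) (e 7) (e 6) := by
  constructor <;> apply ext_coords <;>
    simp [mul_a, mul_b, neg_a, neg_b, one_a, one_b] <;> simp [e, eNat]

lemma isTriple_e_two_four_six : IsTriple (e 2) (e 4) (e 6) := by
  constructor <;> apply ext_coords <;>
    simp [mul_a, mul_b, neg_a, neg_b, one_a, one_b] <;> simp [e, eNat]

lemma isTriple_e_two_five_seven : IsTriple (e 2) (e 5) (e 7) := by
  constructor <;> apply ext_coords <;>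
    simp [mul_a, mul_b, neg_a, neg_b, one_a, one_b] <;> simp [e, eNat]

lemma isTriple_e_three_four_seven : IsTriple (e 3) (e 4) (e 7) := by
  constructor <;> apply ext_coords <;>
    simp [mul_a, mul_b, neg_a, neg_b, one_a, one_b] <;> simp [e, eNat]

lemma isTriple_e_three_six_five : IsTriple (e 3) (e 6) (e 5) := by
  constructor <;> apply ext_coords <;>
    simp [mul_a, mul_b, neg_a, neg_b, one_a, one_b] <;> simp [e, eNat]

/-- Every octonion lies in some slice `ℂ_J`. -/
lemma exists_mem_sliceC (s : Oct) : ∃ J ∈ unitSphere, s ∈ sliceC J := by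
  set n : ℝ := s.a.imI ^ 2 + s.a.imJ ^ 2 + s.a.imK ^ 2 + s.b.re ^ 2 + s.b.imI ^ 2 +
    s.b.imJ ^ 2 + s.b.imK ^ 2 with hn
  have hn0 : 0 ≤ n := by positivity
  rcases hn0.eq_or_lt with h0 | hpos
  · refine ⟨e 1, isTriple_e_one_two_three.sq₁, s.a.re, 0, ?_⟩
    rw [zero_smul, add_zero]
    apply ext_coords <;> simp [smul_a, smul_b, one_a, one_b] <;> nlinarith
  · have hr : √n ≠ 0 := (Real.sqrt_pos.2 hpos).ne'
    have hr2 : √n ^ 2 = n := Real.sq_sqrt hn0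
    refine ⟨(√n)⁻¹ • (s - s.a.re • (1 : Oct)), ?_, s.a.re, √n, ?_⟩
    · show _ * _ = _
      apply ext_coords <;>
        simp [mul_a, mul_b, smul_a, smul_b, sub_a, sub_b, neg_a, neg_b, one_a, one_b] <;>
        field_simp <;> linarith
    · rw [smul_inv_smul₀ hr]
      abel

end Oct

section Relations

variable {V : Type*} [NormedAddCommGroup V] [NormedSpace ℝ V] [OctBimodule V]

lemma lmo_one : (lmo 1 : V →L[ℝ] V) = 1 := by
  ext x; exact OctBimodule.lm_one x

lemma rmo_one : (rmo 1 : V →L[ℝ] V) = 1 := by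
  ext x; exact OctBimodule.rm_one x

lemma lmo_neg (p : Oct) : (lmo (-p) : V →L[ℝ] V) = -lmo p :=
  map_neg (OctBimodule.lm : Oct →ₗ[ℝ] V →L[ℝ] V) p

lemma rmo_neg (p : Oct) : (rmo (-p) : V →L[ℝ] V) = -rmo p :=
  map_neg (OctBimodule.rm : Oct →ₗ[ℝ] V →L[ℝ] V) p

lemma norm_rmo_apply (p : Oct) (x : V) : ‖rmo p x‖ = ‖p‖ * ‖x‖ := OctBimodule.norm_rm p x

lemma assoc_left_eq_middle (p q : Oct) :
    (lmo (p * q) - lmo p * lmo q : V →L[ℝ] V) = rmo p * lmo q - lmo q * rmo p := by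
  ext x; exact OctBimodule.assoc_cyc₁ p q x

lemma assoc_left_eq_right (p q : Oct) :
    (lmo (p * q) - lmo p * lmo q : V →L[ℝ] V) = rmo q * rmo p - rmo (p * q) := by
  ext x; exact OctBimodule.assoc_cyc₂ p q x

lemma assoc_left_self (p : Oct) : (lmo (p * p) : V →L[ℝ] V) = lmo p * lmo p := by
  ext x
  have h := OctBimodule.assoc_alt p p x
  change OctBimodule.lm (p * p) x = OctBimodule.lm p (OctBimodule.lm p x)
  linear_combination (norm := module) (1 / 2 : ℝ) • h

lemma rmo_mul_self (p : Oct) : (rmo p * rmo p : V →L[ℝ] V) = rmo (p * p) := by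
  have h := assoc_left_eq_right (V := V) p p
  rw [assoc_left_self, sub_self] at h
  exact sub_eq_zero.1 h.symm

lemma rmo_mul_lmo_self (p : Oct) : (rmo p * lmo p : V →L[ℝ] V) = lmo p * rmo p := by
  have h := assoc_left_eq_middle (V := V) p p
  rw [assoc_left_self, sub_self] at h
  exact sub_eq_zero.1 h.symm

lemma rmo_mul_self_of_sq {p : Oct} (hp : p * p = -1) : (rmo p * rmo p : V →L[ℝ] V) = -1 := by
  rw [rmo_mul_self, hp, rmo_neg, rmo_one]

lemma lmo_mul_self_of_sq {p : Oct} (hp : p * p = -1) : (lmo p * lmo p : V →L[ℝ] V) = -1 := by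
  rw [← assoc_left_self, hp, lmo_neg, lmo_one]

lemma lmo_mul_lmo_of_isTriple {p q r : Oct} (h : IsTriple p q r) :
    (lmo q * lmo p : V →L[ℝ] V) = -(lmo p * lmo q) := by
  ext x
  have h' := OctBimodule.assoc_alt p q x
  rw [h.mul₁₂, h.mul₂₁, map_neg] at h'
  change OctBimodule.lm q (OctBimodule.lm p x) = -OctBimodule.lm p (OctBimodule.lm q x)
  simp only [neg_apply] at h'
  linear_combination (norm := module) -h'

lemma rmo_mul_rmo_of_isTriple {p q r : Oct} (h : IsTriple p q r) :
    (rmo q * rmo p : V →L[ℝ] V) = -(rmo p * rmo q) := by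
  have h₁ := assoc_left_eq_right (V := V) p q
  have h₂ := assoc_left_eq_right (V := V) q p
  rw [h.mul₁₂] at h₁
  rw [h.mul₂₁, lmo_neg, rmo_neg, lmo_mul_lmo_of_isTriple h] at h₂
  linear_combination (norm := noncomm_ring) -h₁ - h₂

/-- For a quaternionic triple `p, q, r`, the sum of `x ↦ (p x) p` and `x ↦ (q x) q` anticommutes
with `x ↦ x r + r x`. -/
lemma anticomm_of_isTriple {p q r : Oct} (h : IsTriple p q r) :
    ((rmo p * lmo p + rmo q * lmo q) * (rmo r + lmo r) +
      (rmo r + lmo r) * (rmo p * lmo p + rmo q * lmo q) : V →L[ℝ] V) = 0 := by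
  have a₁ := assoc_left_eq_middle (V := V) r p
  have a₂ := assoc_left_eq_right (V := V) r p
  have a₃ := assoc_left_eq_middle (V := V) p r
  have b₁ := assoc_left_eq_middle (V := V) r q
  have b₂ := assoc_left_eq_right (V := V) r q
  have b₃ := assoc_left_eq_middle (V := V) q r
  have c := assoc_left_eq_right (V := V) p q
  rw [h.mul₃₁] at a₁ a₂
  rw [h.mul₁₃, lmo_neg] at a₃
  rw [h.mul₃₂, lmo_neg] at b₁ b₂
  rw [rmo_neg] at b₂
  rw [h.mul₂₃] at b₃
  rw [h.mul₁₂] at c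
  have lp := lmo_mul_self_of_sq (V := V) h.sq₁
  have lq := lmo_mul_self_of_sq (V := V) h.sq₂
  have rp := rmo_mul_self_of_sq (V := V) h.sq₁
  have rq := rmo_mul_self_of_sq (V := V) h.sq₂
  have cp := rmo_mul_lmo_self (V := V) p
  have cq := rmo_mul_lmo_self (V := V) q
  have l₁ := lmo_mul_lmo_of_isTriple (V := V) h
  have l₂ := lmo_mul_lmo_of_isTriple (V := V) h.rotate
  have l₃ := lmo_mul_lmo_of_isTriple (V := V) h.rotate.rotate
  have r₁ := rmo_mul_rmo_of_isTriple (V := V) h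
  have r₂ := rmo_mul_rmo_of_isTriple (V := V) h.rotate
  have r₃ := rmo_mul_rmo_of_isTriple (V := V) h.rotate.rotate
  generalize (lmo p : V →L[ℝ] V) = Lp at *
  generalize (lmo q : V →L[ℝ] V) = Lq at *
  generalize (lmo r : V →L[ℝ] V) = Lr at *
  generalize (rmo p : V →L[ℝ] V) = Rp at *
  generalize (rmo q : V →L[ℝ] V) = Rq at *
  generalize (rmo r : V →L[ℝ] V) = Rr at *
  have hp : (Rp * Lp) * (Rr + Lr) + (Rr + Lr) * (Rp * Lp) = Rp * Rq + Rr - Lp * Lq + Lr := by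
    linear_combination (norm := noncomm_ring) Rp * a₁ - Rp * a₂ - Lp * a₃ + r₃ * Lp + cp * Lr
      - rp * Rr - lp * Lr + l₃ * Rp + Lr * cp
  have hq : (Rq * Lq) * (Rr + Lr) + (Rr + Lr) * (Rq * Lq) = Rp * Rq + Rr - Lp * Lq + Lr := by
    linear_combination (norm := noncomm_ring) Rq * b₁ - Rq * b₂ - Lq * b₃ + r₂ * Lq + cq * Lr
      - rq * Rr - lq * Lr + l₂ * Rq + Lr * cq - r₁ + l₁
  linear_combination (norm := noncomm_ring) hp + hq + 2 * c + 2 * r₁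

lemma anticomm_self_of_sq {r : Oct} (hr : r * r = -1) :
    ((rmo r * lmo r) * (rmo r + lmo r) + (rmo r + lmo r) * (rmo r * lmo r) : V →L[ℝ] V) =
      (-2 : ℝ) • (rmo r + lmo r) := by
  have l := lmo_mul_self_of_sq (V := V) hr
  have r' := rmo_mul_self_of_sq (V := V) hr
  have c := rmo_mul_lmo_self (V := V) r
  generalize (lmo r : V →L[ℝ] V) = L at *
  generalize (rmo r : V →L[ℝ] V) = R at *
  have : (-2 : ℝ) • (R + L) = -2 * (R + L) := by
    rw [show (-2 : ℝ) • (R + L) = -((2 : ℕ) • (R + L)) by module]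
    noncomm_ring
  rw [this]
  linear_combination (norm := noncomm_ring) 2 * r' * L + 2 * R * l - R * c - c * L

/-- Every octonionic unit lies on three quaternionic triples of the basis, so the operator
`∑ (e_i x) e_i` is controlled by its anticommutators with `x ↦ x r + r x`. -/
lemma rmo_add_lmo_eq_zero {r p₁ q₁ p₂ q₂ p₃ q₃ : Oct} (h₁ : IsTriple p₁ q₁ r)
    (h₂ : IsTriple p₂ q₂ r) (h₃ : IsTriple p₃ q₃ r)
    (hsum : (rmo p₁ * lmo p₁ + rmo q₁ * lmo q₁ + (rmo p₂ * lmo p₂ + rmo q₂ * lmo q₂) +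
      (rmo p₃ * lmo p₃ + rmo q₃ * lmo q₃) + rmo r * lmo r : V →L[ℝ] V) = (5 : ℝ) • 1) :
    (rmo r + lmo r : V →L[ℝ] V) = 0 := by
  have k₁ := anticomm_of_isTriple (V := V) h₁
  have k₂ := anticomm_of_isTriple (V := V) h₂
  have k₃ := anticomm_of_isTriple (V := V) h₃
  have k := anticomm_self_of_sq (V := V) h₁.sq₃
  generalize (rmo r + lmo r : V →L[ℝ] V) = S at *
  have hl := congrArg (· * S) hsum
  have hr := congrArg (S * ·) hsum
  simp only [add_mul, mul_add, smul_mul_assoc, mul_smul_comm, one_mul, mul_one] at *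
  have : (12 : ℝ) • S = 0 := by
    linear_combination (norm := module) k₁ + k₂ + k₃ + k - hl - hr
  exact (smul_eq_zero.1 this).resolve_left (by norm_num)

lemma rmo_mul_lmo_eq_one {r : Oct} (hr : r * r = -1) (h : (rmo r + lmo r : V →L[ℝ] V) = 0) :
    (rmo r * lmo r : V →L[ℝ] V) = 1 := by
  rw [eq_neg_of_add_eq_zero_right h, mul_neg, rmo_mul_self_of_sq hr, neg_neg]

variable (V) in
/-- The real-part projection of a nonzero bimodule does not vanish. -/
lemma reO_ne_zero [Nontrivial V] : reO V ≠ 0 := by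
  intro h
  have hs : (∑ i : Fin 7, rmo (e i.succ) * lmo (e i.succ) : V →L[ℝ] V) = (5 : ℝ) • 1 := by
    have h' : (5 / 12 : ℝ) • (1 : V →L[ℝ] V) -
      (1 / 12 : ℝ) • ∑ i : Fin 7, rmo (e i.succ) * lmo (e i.succ) = 0 := h
    linear_combination (norm := module) (-12 : ℝ) • h'
  have hs' : (rmo (e 1) * lmo (e 1) + rmo (e 2) * lmo (e 2) + rmo (e 3) * lmo (e 3) +
      rmo (e 4) * lmo (e 4) + rmo (e 5) * lmo (e 5) + rmo (e 6) * lmo (e 6) +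
      rmo (e 7) * lmo (e 7) : V →L[ℝ] V) = (5 : ℝ) • 1 := by
    rw [← hs, Fin.sum_univ_seven]
    rfl
  have t₁ := isTriple_e_one_two_three
  have t₂ := isTriple_e_one_four_five
  have t₃ := isTriple_e_one_seven_six
  have t₄ := isTriple_e_two_four_six
  have t₅ := isTriple_e_two_five_seven
  have t₆ := isTriple_e_three_four_seven
  have t₇ := isTriple_e_three_six_five
  have k₁ := rmo_mul_lmo_eq_one t₁.sq₁ (rmo_add_lmo_eq_zero (V := V) t₁.rotate t₂.rotate
    t₃.rotate (by linear_combination (norm := abel) hs'))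
  have k₂ := rmo_mul_lmo_eq_one t₁.sq₂ (rmo_add_lmo_eq_zero (V := V) t₁.rotate.rotate t₄.rotate
    t₅.rotate (by linear_combination (norm := abel) hs'))
  have k₃ := rmo_mul_lmo_eq_one t₁.sq₃ (rmo_add_lmo_eq_zero (V := V) t₁ t₆.rotate
    t₇.rotate (by linear_combination (norm := abel) hs'))
  have k₄ := rmo_mul_lmo_eq_one t₂.sq₂ (rmo_add_lmo_eq_zero (V := V) t₂.rotate.rotate
    t₄.rotate.rotate t₆.rotate.rotate (by linear_combination (norm := abel) hs'))
  have k₅ := rmo_mul_lmo_eq_one t₂.sq₃ (rmo_add_lmo_eq_zero (V := V) t₂ t₅.rotate.rotate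
    t₇ (by linear_combination (norm := abel) hs'))
  have k₆ := rmo_mul_lmo_eq_one t₃.sq₃ (rmo_add_lmo_eq_zero (V := V) t₃ t₄
    t₇.rotate.rotate (by linear_combination (norm := abel) hs'))
  have k₇ := rmo_mul_lmo_eq_one t₅.sq₃ (rmo_add_lmo_eq_zero (V := V) t₅ t₆
    t₃.rotate.rotate (by linear_combination (norm := abel) hs'))
  rw [k₁, k₂, k₃, k₄, k₅, k₆, k₇] at hs'
  have : (2 : ℝ) • (1 : V →L[ℝ] V) = 0 := by
    linear_combination (norm := module) hs'
  exact (smul_ne_zero two_ne_zero one_ne_zero) this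

end Relations

section SlicePowers

variable {A : Type*} [NormedRing A] [NormedAlgebra ℝ A]

/-- If `ρ Bⁿ a = ρ a Bⁿ` for all `n`, where `a² = -1`, then the elements `X` with
`ρ X a = ρ a X` include a closed subalgebra containing `a` and `B`. -/
lemma exists_isClosed_subalgebra_of_pow {ρ a B : A} (ha : a * a = -1)
    (h : ∀ n, ρ * B ^ n * a = ρ * a * B ^ n) :
    ∃ C : Subalgebra ℝ A, IsClosed (C : Set A) ∧ a ∈ C ∧ B ∈ C ∧
      ∀ X ∈ C, ρ * X * a = ρ * a * X := by
  let G : Set A := Set.range (fun n => ρ * B ^ n) ∪ Set.range (fun n => ρ * B ^ n * a)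
  let M : Submodule ℝ A := (Submodule.span ℝ G).topologicalClosure
  have hG : G ⊆ M := Submodule.subset_span.trans (Submodule.le_topologicalClosure _)
  have hMc : IsClosed (M : Set A) := Submodule.isClosed_topologicalClosure _
  let C : Subalgebra ℝ A :=
    { carrier := {X | ∀ m ∈ M, m * X ∈ M ∧ m * X * a = m * a * X}
      mul_mem' := fun {X Y} hX hY m hm => by
        obtain ⟨hX₁, hX₂⟩ := hX m hm
        obtain ⟨hY₁, hY₂⟩ := hY _ hX₁
        have e : m * (X * Y) = m * X * Y := (mul_assoc m X Y).symm
        exact ⟨by rwa [e], by rw [e, hY₂, hX₂, mul_assoc]⟩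
      add_mem' := fun {X Y} hX hY m hm => by
        obtain ⟨hX₁, hX₂⟩ := hX m hm
        obtain ⟨hY₁, hY₂⟩ := hY m hm
        rw [mul_add, add_mul, mul_add, hX₂, hY₂]
        exact ⟨M.add_mem hX₁ hY₁, rfl⟩
      algebraMap_mem' := fun r m hm => by
        rw [Algebra.algebraMap_eq_smul_one, mul_smul_one, mul_smul_one, smul_mul_assoc]
        exact ⟨M.smul_mem r hm, rfl⟩ }
  have hCc : IsClosed (C : Set A) := by
    have : (C : Set A) = ⋂ m ∈ M, {X | m * X ∈ M} ∩ {X | m * X * a = m * a * X} := by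
      ext X
      simp only [Set.mem_iInter]
      rfl
    rw [this]
    exact isClosed_biInter fun m _ =>
      (hMc.preimage (continuous_const_mul m)).inter (isClosed_eq (by fun_prop) (by fun_prop))
  have key : ∀ X : A, (∀ m ∈ G, m * X ∈ M ∧ m * X * a = m * a * X) → X ∈ C := by
    intro X hX
    let N : Submodule ℝ A :=
      { carrier := {m | m * X ∈ M ∧ m * X * a = m * a * X}
        add_mem' := fun {x y} hx hy => by
          refine ⟨?_, ?_⟩
          · rw [add_mul]; exact M.add_mem hx.1 hy.1
          · rw [add_mul, add_mul, add_mul, add_mul, hx.2, hy.2]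
        zero_mem' := by simp
        smul_mem' := fun r x hx => by
          refine ⟨?_, ?_⟩
          · rw [smul_mul_assoc]; exact M.smul_mem r hx.1
          · simp only [smul_mul_assoc, hx.2] }
    have hN : IsClosed (N : Set A) :=
      (hMc.preimage (continuous_mul_const X)).inter
        (isClosed_eq (f := fun m => m * X * a) (g := fun m => m * a * X)
          (by fun_prop) (by fun_prop))
    exact fun m hm => Submodule.topologicalClosure_minimal _ (Submodule.span_le.2 (show G ⊆ N from hX)) hN hm
  have hp : ∀ n, ρ * B ^ n ∈ M := fun n => hG (Or.inl ⟨n, rfl⟩)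
  have hq : ∀ n, ρ * B ^ n * a ∈ M := fun n => hG (Or.inr ⟨n, rfl⟩)
  have hs : ∀ n, ρ * B ^ n * a * B = ρ * B ^ (n + 1) * a := fun n => by
    rw [h, h, mul_assoc, ← pow_succ]
  refine ⟨C, hCc, key a ?_, key B ?_, fun X hX => ?_⟩
  · rintro _ (⟨n, rfl⟩ | ⟨n, rfl⟩)
    · exact ⟨hq n, rfl⟩
    · refine ⟨?_, rfl⟩
      simp only [mul_assoc _ a a, ha, mul_neg, mul_one]
      exact M.neg_mem (hp n)
  · rintro _ (⟨n, rfl⟩ | ⟨n, rfl⟩)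
    · simp only [hs]
      rw [mul_assoc ρ, ← pow_succ]
      exact ⟨hp _, rfl⟩
    · refine ⟨by rw [hs]; exact hq _, ?_⟩
      rw [hs, mul_assoc _ a a, mul_assoc _ a a, ha, mul_neg_one, mul_neg_one, neg_mul,
        mul_assoc ρ, ← pow_succ]
  · have := hp 0
    rw [pow_zero, mul_one] at this
    exact (hX ρ this).2

lemma exists_inverse_one_sub_mem_of_isClosed [HasSummableGeomSeries A] {C : Subalgebra ℝ A}
    (hC : IsClosed (C : Set A)) {X : A} (hX : X ∈ C) (h : ‖X‖ < 1) :
    ∃ Y ∈ C, (1 - X) * Y = 1 ∧ Y * (1 - X) = 1 := by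
  have hs : HasSum (fun n : ℕ => X ^ n) (∑' n : ℕ, X ^ n) :=
    (summable_geometric_of_norm_lt_one h).hasSum
  exact ⟨_, hC.mem_of_tendsto hs (.of_forall fun s => sum_mem fun n _ => pow_mem hX n),
    mul_neg_geom_series X h, geom_series_mul_neg X h⟩

end SlicePowers

section Slice

variable {V : Type*} [NormedAddCommGroup V] [NormedSpace ℝ V] [OctBimodule V]

lemma rmo_smul_one_add_smul (x y : ℝ) (J : Oct) :
    (rmo (x • (1 : Oct) + y • J) : V →L[ℝ] V) = x • 1 + y • rmo J := by
  change OctBimodule.rm _ = x • (1 : V →L[ℝ] V) + y • OctBimodule.rm J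
  rw [map_add, map_smul, map_smul]
  congr 2
  exact rmo_one

lemma rmo_sub (p q : Oct) : (rmo (p - q) : V →L[ℝ] V) = rmo p - rmo q :=
  map_sub (OctBimodule.rm : Oct →ₗ[ℝ] V →L[ℝ] V) p q

lemma norm_rmo_le (p : Oct) : ‖(rmo p : V →L[ℝ] V)‖ ≤ ‖p‖ :=
  ContinuousLinearMap.opNorm_le_bound _ (norm_nonneg p) fun x => (norm_rmo_apply p x).le

lemma rmo_mem_of_mem_sliceC {J : Oct} {C : Subalgebra ℝ (V →L[ℝ] V)} (hJ : rmo J ∈ C)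
    {s : Oct} (hs : s ∈ sliceC J) : rmo s ∈ C := by
  obtain ⟨x, y, rfl⟩ := hs
  rw [rmo_smul_one_add_smul]
  exact C.add_mem (C.smul_mem C.one_mem x) (C.smul_mem hJ y)

lemma cJLiftPA_of_mem {J : Oct} {C : Subalgebra ℝ (V →L[ℝ] V)}
    (hC : ∀ X ∈ C, reO V * X * rmo J = reO V * rmo J * X) {X : V →L[ℝ] V} (hX : X ∈ C) :
    CJLiftPA J X := by
  rintro n - v s ⟨x, y, rfl⟩
  have h := hC _ (pow_mem hX n)
  have : reO V * X ^ n * rmo (x • (1 : Oct) + y • J) =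
      reO V * rmo (x • (1 : Oct) + y • J) * X ^ n := by
    simp only [rmo_smul_one_add_smul, mul_add, add_mul, mul_smul_comm, smul_mul_assoc, h,
      mul_one]
  exact congr($this v)

lemma CJLiftPA.reO_mul_pow_mul {J : Oct} {S : V →L[ℝ] V} (h : CJLiftPA J S) {s : Oct}
    (hs : s ∈ sliceC J) (n : ℕ) : reO V * S ^ n * rmo s = reO V * rmo s * S ^ n := by
  rcases n.eq_zero_or_pos with rfl | hn
  · rw [pow_zero, mul_one, mul_one]
  · ext v
    exact h n hn v s hs

lemma IsPowerAssoc.reO_mul_pow_mul {T : V →L[ℝ] V} (h : IsPowerAssoc T) (s : Oct) (n : ℕ) :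
    reO V * T ^ n * rmo s = reO V * rmo s * T ^ n := by
  ext v
  have := h n s v
  simp only [Bop, sub_apply, map_sub] at this
  exact (sub_eq_zero.1 this).symm

lemma mem_sliceC_self (J : Oct) : J ∈ sliceC J := ⟨0, 1, by rw [zero_smul, zero_add, one_smul]⟩

lemma mem_pfResSlice_of_mul_eq_one {J s : Oct} (hs : s ∈ sliceC J) {T Y : V →L[ℝ] V}
    (h₁ : (rmo s - T) * Y = 1) (h₂ : Y * (rmo s - T) = 1) (hY : CJLiftPA J Y) :
    s ∈ pfResSlice T J := by
  let u : (V →L[ℝ] V)ˣ := ⟨rmo s - T, Y, h₁, h₂⟩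
  have hu : Ring.inverse (rmo s - T) = Y := Ring.inverse_unit u
  exact ⟨hs, u.isUnit, by rwa [hu]⟩

end Slice

section Spectrum

variable {V : Type*} [NormedAddCommGroup V] [NormedSpace ℝ V] [OctBimodule V]

/-- The inverse of right multiplication by a nonzero `s ∈ ℂ_J`. -/
lemma exists_inverse_rmo {J s : Oct} (hJ : J ∈ unitSphere) (hs : s ∈ sliceC J) (h0 : 0 < ‖s‖)
    [Nontrivial V] :
    ∃ Q : V →L[ℝ] V, rmo s * Q = 1 ∧ Q * rmo s = 1 ∧ ‖Q‖ ≤ ‖s‖⁻¹ ∧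
      ∀ C : Subalgebra ℝ (V →L[ℝ] V), rmo J ∈ C → Q ∈ C := by
  obtain ⟨x, y, rfl⟩ := hs
  have ha := rmo_mul_self_of_sq (V := V) hJ
  set s := x • (1 : Oct) + y • J with hs
  have hr : (rmo s : V →L[ℝ] V) = x • 1 + y • rmo J := rmo_smul_one_add_smul x y J
  have e₁ : (rmo s * (x • 1 - y • rmo J) : V →L[ℝ] V) = (x ^ 2 + y ^ 2) • 1 := by
    rw [hr]
    simp only [mul_sub, add_mul, mul_smul_comm, smul_mul_assoc, ha, mul_one, one_mul]
    module
  have e₂ : ((x • 1 - y • rmo J) * rmo s : V →L[ℝ] V) = (x ^ 2 + y ^ 2) • 1 := by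
    rw [hr]
    simp only [mul_add, sub_mul, mul_smul_comm, smul_mul_assoc, ha, mul_one, one_mul]
    module
  have hn : x ^ 2 + y ^ 2 ≠ 0 := by
    intro h
    have hx : x = 0 := by nlinarith [sq_nonneg x, sq_nonneg y]
    have hy : y = 0 := by nlinarith [sq_nonneg x, sq_nonneg y]
    rw [hs, hx, hy, zero_smul, zero_smul, add_zero, norm_zero] at h0
    exact h0.false
  have k₁ : (rmo s * ((x ^ 2 + y ^ 2)⁻¹ • (x • 1 - y • rmo J)) : V →L[ℝ] V) = 1 := by
    rw [mul_smul_comm, e₁, inv_smul_smul₀ hn]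
  refine ⟨(x ^ 2 + y ^ 2)⁻¹ • (x • 1 - y • rmo J), k₁, ?_, ?_, fun C hC => ?_⟩
  · rw [smul_mul_assoc, e₂, inv_smul_smul₀ hn]
  · refine ContinuousLinearMap.opNorm_le_bound _ (inv_nonneg.2 h0.le) fun v => ?_
    rw [inv_mul_eq_div, le_div_iff₀ h0, mul_comm, ← norm_rmo_apply]
    exact (congrArg norm congr($k₁ v)).le
  · exact C.smul_mem (C.sub_mem (C.smul_mem C.one_mem x) (C.smul_mem hC y)) _

lemma mem_pfResSlice_of_norm_lt [CompleteSpace V] [Nontrivial V] {T : V →L[ℝ] V}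
    (hT : IsPowerAssoc T) {J s : Oct} (hJ : J ∈ unitSphere) (hs : s ∈ sliceC J)
    (h : ‖T‖ < ‖s‖) : s ∈ pfResSlice T J ∧
      ‖Ring.inverse (rmo s - T)‖ ≤ (‖s‖ - ‖T‖)⁻¹ := by
  have h0 : 0 < ‖s‖ := (norm_nonneg T).trans_lt h
  obtain ⟨Q, q₁, q₂, hQ, hQC⟩ := exists_inverse_rmo (V := V) hJ hs h0
  obtain ⟨C, hC, haC, hTC, hlift⟩ := exists_isClosed_subalgebra_of_pow
    (rmo_mul_self_of_sq (V := V) hJ) (fun n => hT.reO_mul_pow_mul J n)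
  have hlt : ‖Q * T‖ < 1 := by
    refine (norm_mul_le _ _).trans_lt ?_
    calc ‖Q‖ * ‖T‖ ≤ ‖s‖⁻¹ * ‖T‖ := by gcongr
      _ < 1 := by rwa [inv_mul_eq_div, div_lt_one h0]
  obtain ⟨Y, hYC, y₁, y₂⟩ :=
    exists_inverse_one_sub_mem_of_isClosed hC (C.mul_mem (hQC C haC) hTC) hlt
  have hf : rmo s - T = rmo s * (1 - Q * T) := by
    rw [mul_sub, mul_one, ← mul_assoc, q₁, one_mul]
  have h₁ : (rmo s - T) * (Y * Q) = 1 := by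
    rw [hf, mul_assoc, ← mul_assoc _ Y, y₁, one_mul, q₁]
  have h₂ : (Y * Q) * (rmo s - T) = 1 := by
    rw [hf, mul_assoc, ← mul_assoc Q, q₂, one_mul, y₂]
  have hmem := mem_pfResSlice_of_mul_eq_one hs h₁ h₂
    (cJLiftPA_of_mem hlift (C.mul_mem hYC (hQC C haC)))
  refine ⟨hmem, ContinuousLinearMap.opNorm_le_bound _ (inv_nonneg.2 (sub_pos.2 h).le)
    fun v => ?_⟩
  have h₃ := congr($(Ring.mul_inverse_cancel _ hmem.2.1) v)
  set w := (Ring.inverse (rmo s - T) : V →L[ℝ] V) v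
  have h₄ : rmo s w - T w = v := h₃
  rw [inv_mul_eq_div, le_div_iff₀ (sub_pos.2 h)]
  calc ‖w‖ * (‖s‖ - ‖T‖) = ‖rmo s w‖ - ‖T‖ * ‖w‖ := by rw [norm_rmo_apply]; ring
    _ ≤ ‖rmo s w‖ - ‖T w‖ := by gcongr; exact T.le_opNorm w
    _ ≤ ‖rmo s w - T w‖ := norm_sub_norm_le _ _
    _ = ‖v‖ := by rw [h₄]

lemma sub_mem_sliceC {J s t : Oct} (hs : s ∈ sliceC J) (ht : t ∈ sliceC J) :
    s - t ∈ sliceC J := by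
  obtain ⟨x, y, rfl⟩ := hs
  obtain ⟨x', y', rfl⟩ := ht
  exact ⟨x - x', y - y', by module⟩

/-- The slice-resolvent set is relatively open in the slice. -/
lemma exists_ball_inter_sliceC_subset [CompleteSpace V] {T : V →L[ℝ] V} {J s₀ : Oct}
    (hJ : J ∈ unitSphere) (h : s₀ ∈ pfResSlice T J) :
    ∃ ε > 0, Metric.ball s₀ ε ∩ sliceC J ⊆ pfResSlice T J := by
  obtain ⟨hs₀, hu, hlift₀⟩ := h
  set S := Ring.inverse (rmo s₀ - T) with hS
  obtain ⟨C, hC, haC, hSC, hlift⟩ := exists_isClosed_subalgebra_of_pow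
    (rmo_mul_self_of_sq (V := V) hJ) (fun n => hlift₀.reO_mul_pow_mul (mem_sliceC_self J) n)
  refine ⟨(‖S‖ + 1)⁻¹, by positivity, fun s ⟨hsb, hs⟩ => ?_⟩
  rw [mem_ball_iff_norm'] at hsb
  have hd := sub_mem_sliceC hs₀ hs
  have hlt : ‖rmo (s₀ - s) * S‖ < 1 := by
    calc ‖rmo (s₀ - s) * S‖ ≤ ‖s₀ - s‖ * ‖S‖ :=
          (norm_mul_le _ _).trans (by gcongr; exact norm_rmo_le _)
      _ ≤ ‖s₀ - s‖ * (‖S‖ + 1) := by gcongr; linarith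
      _ < (‖S‖ + 1)⁻¹ * (‖S‖ + 1) := by gcongr
      _ = 1 := inv_mul_cancel₀ (by positivity)
  have c₁ : (rmo s₀ - T) * S = 1 := Ring.mul_inverse_cancel _ hu
  have c₂ : S * (rmo s₀ - T) = 1 := Ring.inverse_mul_cancel _ hu
  obtain ⟨Y, hYC, y₁, y₂⟩ := exists_inverse_one_sub_mem_of_isClosed hC
    (C.mul_mem (rmo_mem_of_mem_sliceC haC hd) hSC) hlt
  have hf : rmo s - T = (1 - rmo (s₀ - s) * S) * (rmo s₀ - T) := by
    rw [sub_mul, one_mul, mul_assoc, c₂, mul_one, rmo_sub]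
    abel
  refine mem_pfResSlice_of_mul_eq_one (Y := S * Y) hs ?_ ?_
    (cJLiftPA_of_mem hlift (C.mul_mem hSC hYC))
  · rw [hf, mul_assoc, ← mul_assoc _ S, c₁, one_mul, y₁]
  · rw [hf, mul_assoc, ← mul_assoc Y, y₂, one_mul, c₂]

lemma isClosed_sliceC (J : Oct) : IsClosed (sliceC J) := by
  have : sliceC J = (Submodule.span ℝ {(1 : Oct), J} : Set Oct) := by
    ext s
    simp only [SetLike.mem_coe, Submodule.mem_span_pair]
    exact ⟨fun ⟨x, y, h⟩ => ⟨x, y, h.symm⟩, fun ⟨x, y, h⟩ => ⟨x, y, h.symm⟩⟩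
  rw [this]
  exact Submodule.closed_of_finiteDimensional _

lemma isClosed_sliceC_diff_pfResSlice [CompleteSpace V] (T : V →L[ℝ] V) {J : Oct}
    (hJ : J ∈ unitSphere) : IsClosed (sliceC J \ pfResSlice T J) := by
  refine isClosed_of_closure_subset fun s hs => ?_
  have hsJ : s ∈ sliceC J := (isClosed_sliceC J).closure_subset (closure_mono Set.sdiff_subset hs)
  refine ⟨hsJ, fun h => ?_⟩
  obtain ⟨ε, hε, hsub⟩ := exists_ball_inter_sliceC_subset hJ h
  obtain ⟨t, ht, htε⟩ := Metric.mem_closure_iff.1 hs ε hε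
  exact ht.2 (hsub ⟨Metric.mem_ball'.2 htε, ht.1⟩)

variable (V) in
lemma norm_one_oct [Nontrivial V] : ‖(1 : Oct)‖ = 1 := by
  obtain ⟨v, hv⟩ := exists_ne (0 : V)
  have h := norm_rmo_apply 1 v
  rw [rmo_one, one_apply_eq_self] at h
  exact (mul_eq_right₀ (norm_ne_zero_iff.2 hv)).1 h.symm

variable (V) in
lemma norm_eq_one_of_mem_unitSphere [Nontrivial V] {J : Oct} (hJ : J ∈ unitSphere) :
    ‖J‖ = 1 := by
  obtain ⟨v, hv⟩ := exists_ne (0 : V)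
  have h := congrArg norm congr($(rmo_mul_self_of_sq (V := V) hJ) v)
  rw [mul_apply_eq_comp, neg_apply, one_apply_eq_self, norm_neg, norm_rmo_apply, norm_rmo_apply, ← mul_assoc] at h
  have h' := (mul_eq_right₀ (norm_ne_zero_iff.2 hv)).1 h
  nlinarith [norm_nonneg J]

variable (V) in
lemma norm_le_two_mul_norm_toSlice [Nontrivial V] {J : Oct} (hJ : J ∈ unitSphere) (z : ℂ) :
    ‖z‖ ≤ 2 * ‖toSlice J z‖ := by
  obtain ⟨v, hv⟩ := exists_ne (0 : V)
  have ha := rmo_mul_self_of_sq (V := V) hJ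
  have h : (rmo (z.re • (1 : Oct) + (-z.im) • J) * rmo (toSlice J z) : V →L[ℝ] V) =
      (z.re * z.re + z.im * z.im) • 1 := by
    rw [toSlice, rmo_smul_one_add_smul, rmo_smul_one_add_smul]
    simp only [mul_add, add_mul, mul_smul_comm, smul_mul_assoc, ha, mul_one, one_mul]
    module
  have h' := congrArg norm congr($h v)
  rw [mul_apply_eq_comp, norm_rmo_apply, norm_rmo_apply, smul_apply, one_apply_eq_self, norm_smul, ← mul_assoc,
    ← Complex.normSq_apply, Complex.normSq_eq_norm_sq, Real.norm_of_nonneg (sq_nonneg _)] at h'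
  have h₁ := mul_right_cancel₀ (norm_ne_zero_iff.2 hv) h'
  have h₂ : ‖z.re • (1 : Oct) + (-z.im) • J‖ ≤ 2 * ‖z‖ := by
    refine (norm_add_le _ _).trans ?_
    rw [norm_smul, norm_smul, norm_one_oct V, norm_eq_one_of_mem_unitSphere V hJ, norm_neg]
    have := Complex.abs_re_le_norm z
    have := Complex.abs_im_le_norm z
    simp only [Real.norm_eq_abs]
    linarith
  rcases (norm_nonneg z).eq_or_lt with h0 | h0
  · rw [← h0]; positivity
  · have : ‖z‖ * ‖z‖ ≤ ‖z‖ * (2 * ‖toSlice J z‖) := by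
      nlinarith [norm_nonneg (toSlice J z)]
    exact le_of_mul_le_mul_left this h0

lemma toSlice_mem_sliceC (J : Oct) (z : ℂ) : toSlice J z ∈ sliceC J := ⟨z.re, z.im, rfl⟩

/-- The `ℂ`-valued functional `X ↦ φ (Re (X x)) - i φ (Re (X (x J)))`, through which the
resolvent becomes a holomorphic function. -/
def sliceFunctional (J : Oct) (φ : V →L[ℝ] ℝ) (x : V) : (V →L[ℝ] V) →L[ℝ] ℂ :=
  Complex.ofRealCLM.comp ((φ.comp (reO V)).comp (ContinuousLinearMap.apply ℝ V x)) -
    Complex.I • Complex.ofRealCLM.comp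
      ((φ.comp (reO V)).comp (ContinuousLinearMap.apply ℝ V (rmo J x)))

lemma sliceFunctional_apply (J : Oct) (φ : V →L[ℝ] ℝ) (x : V) (X : V →L[ℝ] V) :
    sliceFunctional J φ x X =
      (φ (reO V (X x)) : ℂ) - Complex.I * (φ (reO V (X (rmo J x))) : ℂ) := rfl

lemma sliceFunctional_mul_rmo_mul {J : Oct} (hJ : J ∈ unitSphere) (φ : V →L[ℝ] ℝ) (x : V)
    {S : V →L[ℝ] V} (hS : CJLiftPA J S) (h : ℂ) :
    sliceFunctional J φ x (S * rmo (toSlice J h) * S) = h * sliceFunctional J φ x (S * S) := by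
  have key : reO V * (S * rmo (toSlice J h) * S) = reO V * (S * S) * rmo (toSlice J h) := by
    have h₁ := hS.reO_mul_pow_mul (toSlice_mem_sliceC J h) 1
    have h₂ := hS.reO_mul_pow_mul (toSlice_mem_sliceC J h) 2
    rw [pow_one] at h₁
    rw [pow_two] at h₂
    rw [h₂, ← mul_assoc, ← mul_assoc, h₁, mul_assoc, mul_assoc]
  have key' : ∀ v, reO V ((S * rmo (toSlice J h) * S : V →L[ℝ] V) v) =
      h.re • reO V ((S * S) v) + h.im • reO V ((S * S) (rmo J v)) := fun v => by
    refine congr($key v).trans ?_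
    rw [toSlice, rmo_smul_one_add_smul]
    simp only [mul_add, mul_smul_comm, mul_one]
    rfl
  have ha : rmo J (rmo J x) = -x := congr($(rmo_mul_self_of_sq (V := V) hJ) x)
  rw [sliceFunctional_apply, sliceFunctional_apply, key', key', ha]
  generalize (S * S : V →L[ℝ] V) = W
  simp only [map_add, map_neg, map_smul, smul_eq_mul, Complex.ofReal_add, Complex.ofReal_mul,
    Complex.ofReal_neg]
  conv_rhs => rw [← Complex.re_add_im h]
  linear_combination (h.im : ℂ) * (φ (reO V (W (rmo J x))) : ℂ) * Complex.I_sq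

lemma differentiableAt_sliceFunctional_inverse [CompleteSpace V] {J : Oct} (hJ : J ∈ unitSphere)
    (φ : V →L[ℝ] ℝ) (x : V) {T : V →L[ℝ] V} {z : ℂ} (hz : toSlice J z ∈ pfResSlice T J) :
    DifferentiableAt ℂ
      (fun z => sliceFunctional J φ x (Ring.inverse (rmo (toSlice J z) - T))) z := by
  obtain ⟨-, ⟨u, hu⟩, hlift⟩ := hz
  let L : ℂ →L[ℝ] V →L[ℝ] V :=
    Complex.reCLM.smulRight 1 + Complex.imCLM.smulRight (rmo J : V →L[ℝ] V)
  have hL : ∀ w, L w = rmo (toSlice J w) := fun w => by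
    rw [toSlice, rmo_smul_one_add_smul]
    rfl
  have h₁ : HasFDerivAt (fun w => (rmo (toSlice J w) : V →L[ℝ] V) - T) L z := by
    simp only [← hL]
    exact L.hasFDerivAt.sub_const T
  have h₂ := hasFDerivAt_ringInverse (𝕜 := ℝ) u
  rw [← Ring.inverse_unit u, hu] at h₂
  set S : V →L[ℝ] V := Ring.inverse (rmo (toSlice J z) - T)
  have h₃ := (sliceFunctional J φ x).hasFDerivAt.comp z (h₂.comp z h₁)
  refine (hasFDerivAt_of_restrictScalars ℝ h₃ (f' := (1 : ℂ →L[ℂ] ℂ).smulRight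
    (-sliceFunctional J φ x (S * S))) ?_).differentiableAt
  ext1 h
  have := sliceFunctional_mul_rmo_mul hJ φ x hlift h
  rw [← hL] at this
  change h * -sliceFunctional J φ x (S * S) = sliceFunctional J φ x (-(S * L h * S))
  rw [map_neg, this, mul_neg]

lemma tendsto_sliceFunctional_inverse [CompleteSpace V] [Nontrivial V] {J : Oct}
    (hJ : J ∈ unitSphere) (φ : V →L[ℝ] ℝ) (x : V) {T : V →L[ℝ] V} (hT : IsPowerAssoc T) :
    Filter.Tendsto (fun z => sliceFunctional J φ x (Ring.inverse (rmo (toSlice J z) - T)))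
      (Filter.cocompact ℂ) (nhds 0) := by
  have hn : Filter.Tendsto (fun z => ‖toSlice J z‖) (Filter.cocompact ℂ) Filter.atTop := by
    refine Filter.tendsto_atTop_mono (fun z => ?_)
      ((tendsto_norm_cocompact_atTop (E := ℂ)).atTop_div_const two_pos)
    linarith [norm_le_two_mul_norm_toSlice V hJ z]
  have hlim : Filter.Tendsto
      (fun z => ‖sliceFunctional J φ x‖ * (‖toSlice J z‖ - ‖T‖)⁻¹) (Filter.cocompact ℂ)
      (nhds 0) := by
    have := (tendsto_inv_atTop_zero.comp
      (Filter.tendsto_atTop_add_const_right _ (-‖T‖) hn)).const_mul ‖sliceFunctional J φ x‖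
    rwa [mul_zero] at this
  refine squeeze_zero_norm' ?_ hlim
  filter_upwards [hn.eventually_gt_atTop ‖T‖] with z hz
  refine (ContinuousLinearMap.le_opNorm _ _).trans ?_
  gcongr
  exact (mem_pfResSlice_of_norm_lt hT hJ (toSlice_mem_sliceC J z) hz).2

lemma nonempty_sliceC_diff_pfResSlice [CompleteSpace V] [Nontrivial V] {T : V →L[ℝ] V}
    (hT : IsPowerAssoc T) {J : Oct} (hJ : J ∈ unitSphere) :
    (sliceC J \ pfResSlice T J).Nonempty := by
  by_contra hne
  have hres : ∀ z, toSlice J z ∈ pfResSlice T J := fun z => by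
    by_contra hz
    exact hne ⟨_, toSlice_mem_sliceC J z, hz⟩
  refine reO_ne_zero V ?_
  obtain ⟨-, hu, -⟩ := hres 0
  have h0 : reO V * Ring.inverse (rmo (toSlice J 0) - T) = 0 := by
    ext x
    refine SeparatingDual.eq_zero_of_forall_dual_eq_zero (R := ℝ) fun φ => ?_
    have hd : Differentiable ℂ
        (fun z => sliceFunctional J φ x (Ring.inverse (rmo (toSlice J z) - T))) :=
      fun z => differentiableAt_sliceFunctional_inverse hJ φ x (hres z)
    have := hd.apply_eq_of_tendsto_cocompact 0 (tendsto_sliceFunctional_inverse hJ φ x hT)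
    rw [sliceFunctional_apply] at this
    simpa using congrArg Complex.re this
  rw [← Ring.inverse_mul_cancel_right _ (reO V) hu, h0, zero_mul]

end Spectrum

/-- Let `V` be a nonzero Banach `𝕆`-bimodule and `T` a power-associative
bounded right para-linear operator.  Then every `s ∈ 𝕆` with `|s| > ‖T‖` lies in `ρ_*(T)`,
and for every `J ∈ 𝕊` the slice push-forward spectrum `σ_{*J}(T) = ℂ_J ∖ ρ_{*J}(T)` is a
nonempty compact subset of `ℂ_J` contained in the closed disk of radius `‖T‖`. -/
theorem statement_12 {V : Type*} [NormedAddCommGroup V] [NormedSpace ℝ V] [CompleteSpace V]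
    [Nontrivial V] [OctBimodule V] (T : V →L[ℝ] V) (hT : IsRightPara T)
    (hpa : IsPowerAssoc T) :
    (∀ s : Oct, ‖T‖ < ‖s‖ → s ∈ pfRes T) ∧
    ∀ J ∈ unitSphere,
      IsCompact (sliceC J \ pfResSlice T J) ∧
      (sliceC J \ pfResSlice T J).Nonempty ∧
      (sliceC J \ pfResSlice T J) ⊆ {s : Oct | ‖s‖ ≤ ‖T‖} := by
  refine ⟨fun s hs => ?_, fun J hJ => ?_⟩
  · obtain ⟨J, hJ, hsJ⟩ := exists_mem_sliceC s
    exact Set.mem_biUnion hJ (mem_pfResSlice_of_norm_lt hpa hJ hsJ hs).1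
  · have hdisk : sliceC J \ pfResSlice T J ⊆ {s : Oct | ‖s‖ ≤ ‖T‖} := fun s hs =>
      not_lt.1 fun h => hs.2 (mem_pfResSlice_of_norm_lt hpa hJ hs.1 h).1
    have : ProperSpace Oct := FiniteDimensional.proper_real Oct
    refine ⟨Metric.isCompact_of_isClosed_isBounded (isClosed_sliceC_diff_pfResSlice T hJ) ?_,
      nonempty_sliceC_diff_pfResSlice hpa hJ, hdisk⟩
    exact (Metric.isBounded_closedBall (x := (0 : Oct)) (r := ‖T‖)).subset fun s hs =>
      mem_closedBall_zero_iff.2 (hdisk hs)
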